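/- arXiv:2012.08265 — 3 statements merged into one kernel-verified Lean document; each statement's English description precedes it below -/
import Mathlib

section
/- Let M be exponentially distributed with parameter λ > 0 (density f(x) = λ e^{−λx} for x ≥ 0) and let b < 0. If 0 = m_0 < m_1 < ⋯ < m_{N−1} < m_N = ∞ together with u_k = E[M | m_{k−1} ≤ M < m_k] satisfy the nearest-neighbor conditions m_k = (u_k + u_{k+1})/2 + b for k = 1, …, N−1 (i.e., they form an equilibrium with N bins), then N ≤ ⌊−1/(2bλ) + 1⌋. -/
open MeasureTheory Set Filter

/-- Conditional mean `E[M | M ∈ s]` of a random variable with density `f`. -/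
noncomputable def condMean (f : ℝ → ℝ) (s : Set ℝ) : ℝ :=
  (∫ x in s, x * f x) / (∫ x in s, f x)

/-- The bin (interval) of real numbers between two extended-real edges `lo` and `hi`. -/
def ebin (lo hi : EReal) : Set ℝ := {x : ℝ | lo ≤ (x : EReal) ∧ (x : EReal) < hi}

/-- Edges `m_0 = m_L < m_1 < ⋯ < m_{N−1} < m_N = +∞` of an `N`-bin quantizer with interior
edges `m : Fin (N−1) → ℝ`, for a source supported on `[m_L, ∞)`. -/
noncomputable def edgesL (mL : ℝ) (N : ℕ) (m : Fin (N - 1) → ℝ) (k : ℕ) : EReal :=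
  if hk : k = 0 then (mL : EReal)
  else if h : k ≤ N - 1 then ((m ⟨k - 1, by omega⟩ : ℝ) : EReal)
  else ⊤

/-- `m : Fin (N−1) → ℝ` is the vector of interior edges of an `N`-bin cheap-talk equilibrium
for a source with density `f` supported on `[m_L, ∞)` and bias `b`: the interior edges are
strictly increasing, lie above `m_L`, and every interior edge `m_k` satisfies the
centroid/nearest-neighbor condition
`m_k = (E[M | m_{k−1} ≤ M < m_k] + E[M | m_k ≤ M < m_{k+1}])/2 + b`. -/
def IsEqL (f : ℝ → ℝ) (mL b : ℝ) (N : ℕ) (m : Fin (N - 1) → ℝ) : Prop :=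
  StrictMono m ∧ (∀ k, mL < m k) ∧ ∀ k : Fin (N - 1),
    m k = (condMean f (ebin (edgesL mL N m k.val) (edgesL mL N m (k.val + 1)))
         + condMean f (ebin (edgesL mL N m (k.val + 1)) (edgesL mL N m (k.val + 2)))) / 2 + b

/-- The exponential density with rate `lam`: `f(x) = λ e^{−λx}` for `x ≥ 0`, `0` otherwise. -/
noncomputable def expPDF (lam : ℝ) (x : ℝ) : ℝ :=
  if 0 ≤ x then lam * Real.exp (-lam * x) else 0

/-- The inequality `2 (e^x - 1) ≤ x (e^x + 1)`, equivalent to `2 tanh (x / 2) ≤ x`. -/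
theorem two_mul_exp_sub_one_le {x : ℝ} (hx : 0 ≤ x) :
    2 * (Real.exp x - 1) ≤ x * (Real.exp x + 1) := by
  have hderiv (y : ℝ) : HasDerivAt (fun y => y * (Real.exp y + 1) - 2 * (Real.exp y - 1))
      (1 * (Real.exp y + 1) + y * Real.exp y - 2 * Real.exp y) y :=
    ((hasDerivAt_id y).mul ((Real.hasDerivAt_exp y).add_const 1)).sub
      (((Real.hasDerivAt_exp y).sub_const 1).const_mul 2)
  have hmono : Monotone (fun y : ℝ => y * (Real.exp y + 1) - 2 * (Real.exp y - 1)) := by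
    refine monotone_of_deriv_nonneg (fun y => (hderiv y).differentiableAt) fun y => ?_
    rw [(hderiv y).deriv]
    have h1 : (1 - y) * Real.exp y ≤ Real.exp (-y) * Real.exp y :=
      mul_le_mul_of_nonneg_right (Real.one_sub_le_exp_neg y) (Real.exp_pos y).le
    rw [← Real.exp_add, neg_add_cancel, Real.exp_zero] at h1
    linarith
  have := hmono hx
  simp only [Real.exp_zero] at this
  linarith

theorem hasDerivAt_neg_exp_neg_mul (lam x : ℝ) :
    HasDerivAt (fun x => -Real.exp (-lam * x)) (lam * Real.exp (-lam * x)) x := by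
  refine (((hasDerivAt_id x).const_mul (-lam)).exp).neg.congr_deriv ?_
  simp only [id]
  ring

theorem hasDerivAt_neg_add_inv_mul_exp_neg_mul {lam : ℝ} (hlam : lam ≠ 0) (x : ℝ) :
    HasDerivAt (fun x => (x + 1 / lam) * -Real.exp (-lam * x))
      (x * (lam * Real.exp (-lam * x))) x := by
  refine (((hasDerivAt_id x).add_const (1 / lam)).mul
    (hasDerivAt_neg_exp_neg_mul lam x)).congr_deriv ?_
  simp only [id]
  field_simp
  ring

theorem ebin_coe_coe (a c : ℝ) : ebin a c = Ico a c := by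
  ext x
  simp [ebin]

theorem ebin_coe_top (a : ℝ) : ebin a ⊤ = Ici a := by
  ext x
  simp [ebin, EReal.coe_lt_top]

theorem condMean_expPDF_of_subset {lam : ℝ} {s : Set ℝ} (hs : MeasurableSet s)
    (hpos : s ⊆ Ici 0) :
    condMean (expPDF lam) s =
      (∫ x in s, x * (lam * Real.exp (-lam * x))) / ∫ x in s, lam * Real.exp (-lam * x) := by
  unfold condMean
  congr 1 <;> refine setIntegral_congr_fun hs fun x hx => ?_ <;>
    simp [expPDF, mem_Ici.1 (hpos hx)]

theorem condMean_expPDF_nonneg {lam : ℝ} (hlam : 0 ≤ lam) (s : Set ℝ) :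
    0 ≤ condMean (expPDF lam) s := by
  unfold condMean expPDF
  refine div_nonneg (integral_nonneg fun x => ?_) (integral_nonneg fun x => ?_)
  · dsimp only [Pi.zero_apply]
    split_ifs
    · positivity
    · rw [mul_zero]
  · dsimp only [Pi.zero_apply]
    split_ifs <;> positivity

theorem condMean_expPDF_Ico {lam a c : ℝ} (hlam : 0 < lam) (ha : 0 ≤ a) (hac : a < c) :
    condMean (expPDF lam) (Ico a c) =
      1 / lam + a - (c - a) / (Real.exp (lam * (c - a)) - 1) := by
  rw [condMean_expPDF_of_subset measurableSet_Ico fun x hx => ha.trans hx.1,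
    integral_Ico_eq_integral_Ioc, integral_Ico_eq_integral_Ioc,
    ← intervalIntegral.integral_of_le hac.le, ← intervalIntegral.integral_of_le hac.le,
    intervalIntegral.integral_eq_sub_of_hasDerivAt
      (fun x _ => hasDerivAt_neg_add_inv_mul_exp_neg_mul hlam.ne' x)
      (Continuous.intervalIntegrable (by fun_prop) _ _),
    intervalIntegral.integral_eq_sub_of_hasDerivAt
      (fun x _ => hasDerivAt_neg_exp_neg_mul lam x)
      (Continuous.intervalIntegrable (by fun_prop) _ _)]
  have hE : 1 < Real.exp (lam * (c - a)) :=
    Real.one_lt_exp_iff.2 (mul_pos hlam (sub_pos.2 hac))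
  have hA : Real.exp (-lam * a) = Real.exp (lam * (c - a)) * Real.exp (-lam * c) := by
    rw [← Real.exp_add]
    ring_nf
  have hC := Real.exp_pos (-lam * c)
  rw [hA]
  generalize Real.exp (lam * (c - a)) = E at *
  generalize Real.exp (-lam * c) = C at *
  have hE' : E - 1 ≠ 0 := (sub_pos.2 hE).ne'
  have hden : -C - -(E * C) = C * (E - 1) := by ring
  rw [hden]
  field_simp
  ring

theorem condMean_expPDF_Ici {lam a : ℝ} (hlam : 0 < lam) (ha : 0 ≤ a) :
    condMean (expPDF lam) (Ici a) = a + 1 / lam := by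
  have hlin : Tendsto (fun x : ℝ => lam * x) atTop atTop := tendsto_id.const_mul_atTop hlam
  have hexp : Tendsto (fun x : ℝ => -Real.exp (-lam * x)) atTop (nhds 0) := by
    have := (Real.tendsto_exp_neg_atTop_nhds_zero.comp hlin).neg
    simpa [Function.comp_def] using this
  have hxexp : Tendsto (fun x : ℝ => (x + 1 / lam) * -Real.exp (-lam * x)) atTop (nhds 0) := by
    have h1 := ((Real.tendsto_pow_mul_exp_neg_atTop_nhds_zero 1).comp hlin).const_mul (-1 / lam)
    have h2 := h1.add (hexp.const_mul (1 / lam))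
    simp only [mul_zero, add_zero] at h2
    refine h2.congr fun x => ?_
    simp only [Function.comp_def, pow_one, neg_mul]
    field_simp
    ring
  rw [condMean_expPDF_of_subset measurableSet_Ici fun x hx => ha.trans hx,
    integral_Ici_eq_integral_Ioi, integral_Ici_eq_integral_Ioi,
    integral_Ioi_of_hasDerivAt_of_nonneg'
      (fun x _ => hasDerivAt_neg_add_inv_mul_exp_neg_mul hlam.ne' x)
      (fun x hx => mul_nonneg (ha.trans (le_of_lt hx)) (by positivity)) hxexp,
    integral_Ioi_of_hasDerivAt_of_nonneg'
      (fun x _ => hasDerivAt_neg_exp_neg_mul lam x) (fun x _ => by positivity) hexp]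
  have hA := Real.exp_pos (-lam * a)
  field_simp
  ring

/-- If the centroid `u` of the bin `[a, c)` satisfies `c ≤ u + 1/λ - d`, then also
`u ≤ a + 1/λ - d`. -/
theorem condMean_expPDF_Ico_le {lam a c d : ℝ} (hlam : 0 < lam) (ha : 0 ≤ a) (hac : a < c)
    (h : c ≤ condMean (expPDF lam) (Ico a c) + 1 / lam - d) :
    condMean (expPDF lam) (Ico a c) ≤ a + 1 / lam - d := by
  rw [condMean_expPDF_Ico hlam ha hac] at h ⊢
  have hE : 0 < Real.exp (lam * (c - a)) - 1 :=
    sub_pos.2 (Real.one_lt_exp_iff.2 (mul_pos hlam (sub_pos.2 hac)))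
  have key : 2 / lam ≤ 2 * ((c - a) / (Real.exp (lam * (c - a)) - 1)) + (c - a) := by
    have := two_mul_exp_sub_one_le (mul_nonneg hlam.le (sub_nonneg.2 hac.le))
    rw [div_le_iff₀ hlam, ← sub_nonneg]
    have heq : (2 * ((c - a) / (Real.exp (lam * (c - a)) - 1)) + (c - a)) * lam - 2 =
        (lam * (c - a) * (Real.exp (lam * (c - a)) + 1) - 2 * (Real.exp (lam * (c - a)) - 1)) /
          (Real.exp (lam * (c - a)) - 1) := by
      generalize Real.exp (lam * (c - a)) = E at hE
      have hE' := hE.ne'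
      field_simp
      ring
    rw [heq]
    exact div_nonneg (sub_nonneg.2 this) hE.le
  have h2 : 2 / lam = 1 / lam + 1 / lam := by ring
  linarith

theorem edgesL_zero (mL : ℝ) (N : ℕ) (m : Fin (N - 1) → ℝ) : edgesL mL N m 0 = mL := by
  simp [edgesL]

theorem edgesL_succ (mL : ℝ) {N : ℕ} (m : Fin (N - 1) → ℝ) (k : Fin (N - 1)) :
    edgesL mL N m (k.val + 1) = m k := by
  simp [edgesL, Nat.succ_le_of_lt k.isLt]

theorem edgesL_of_lt (mL : ℝ) {N : ℕ} (m : Fin (N - 1) → ℝ) {k : ℕ} (hk : N - 1 < k) :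
    edgesL mL N m k = ⊤ := by
  simp [edgesL, Nat.ne_of_gt (Nat.zero_lt_of_lt hk), Nat.not_le.2 hk]

/-- In an exponential equilibrium with bias `b`, the centroid of the bin that has `j` bins above
it exceeds its left edge by at most `1/λ + 2 b j`. -/
theorem IsEqL.condMean_expPDF_le {lam b : ℝ} (hlam : 0 < lam) {N : ℕ} {m : Fin (N - 1) → ℝ}
    (heq : IsEqL (expPDF lam) 0 b N m) (j : ℕ) :
    ∀ (k : ℕ) (a : ℝ), k + j = N - 1 → edgesL 0 N m k = a → 0 ≤ a →
      condMean (expPDF lam) (ebin (edgesL 0 N m k) (edgesL 0 N m (k + 1))) ≤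
        a + 1 / lam + 2 * b * j := by
  obtain ⟨hmono, hpos, hnn⟩ := heq
  induction j with
  | zero =>
    intro k a hk hka ha
    rw [hka, edgesL_of_lt 0 m (show N - 1 < k + 1 by omega), ebin_coe_top,
      condMean_expPDF_Ici hlam ha]
    simp
  | succ j ih =>
    intro k a hk hka ha
    have hkN : k < N - 1 := by omega
    have hedge := edgesL_succ 0 m ⟨k, hkN⟩
    have hlt : a < m ⟨k, hkN⟩ := by
      cases k with
      | zero =>
        rw [edgesL_zero, EReal.coe_eq_coe_iff] at hka
        exact hka ▸ hpos _
      | succ i =>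
        rw [edgesL_succ 0 m ⟨i, by omega⟩, EReal.coe_eq_coe_iff] at hka
        exact hka ▸ hmono (Fin.mk_lt_mk.2 (Nat.lt_succ_self i))
    have hnext := ih (k + 1) (m ⟨k, hkN⟩) (by omega) hedge (hpos _).le
    have hk_nn := hnn ⟨k, hkN⟩
    dsimp only at hk_nn hedge
    rw [hka, hedge, ebin_coe_coe] at hk_nn ⊢
    rw [hedge, show k + 1 + 1 = k + 2 from rfl] at hnext
    have := condMean_expPDF_Ico_le (d := -(2 * b * (j + 1))) hlam ha hlt (by linarith)
    push_cast
    linarith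

/-- For an exponential source with parameter `λ > 0` and bias `b < 0`,
any cheap-talk equilibrium with `N` bins satisfies `N ≤ ⌊−1/(2bλ) + 1⌋`. -/
theorem exp_negBias_bins_bounded (lam b : ℝ) (hlam : 0 < lam) (hb : b < 0)
    (N : ℕ) (hN : 1 ≤ N) (m : Fin (N - 1) → ℝ)
    (heq : IsEqL (expPDF lam) 0 b N m) :
    (N : ℤ) ≤ ⌊(-1 / (2 * b * lam) + 1 : ℝ)⌋ := by
  have h := heq.condMean_expPDF_le hlam (N - 1) 0 0 (zero_add _) (edgesL_zero 0 N m) le_rfl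
  have h0 := (condMean_expPDF_nonneg hlam.le _).trans h
  rw [Nat.cast_sub hN, Nat.cast_one] at h0
  have hden : 0 < 2 * -b * lam := by
    have := neg_pos.2 hb
    positivity
  rw [Int.le_floor, Int.cast_natCast, ← sub_le_iff_le_add,
    show -1 / (2 * b * lam) = 1 / (2 * -b * lam) by rw [← neg_div_neg_eq]; ring_nf,
    le_div_iff₀ hden]
  have h1 := mul_nonneg h0 hlam.le
  have h2 : (0 + 1 / lam + 2 * b * ((N : ℝ) - 1)) * lam = 1 + 2 * b * (N - 1) * lam := by
    field_simp
    ring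
  linarith
end

section
/- Let M ~ N(μ, σ²) be a Gaussian random variable with σ > 0. Then for every t ≥ μ, E[M | M ≥ t] − t < σ, i.e., μ + σ·φ((t−μ)/σ)/(1 − Φ((t−μ)/σ)) − t < σ; and symmetrically, for every t ≤ μ, t − E[M | M ≤ t] < σ, i.e., t − μ + σ·φ((t−μ)/σ)/Φ((t−μ)/σ) < σ. Here φ and Φ are the standard normal pdf and cdf. -/
open MeasureTheory Set

/-- The standard Gaussian density `φ(x) = e^{−x²/2}/√(2π)`. -/
noncomputable def stdGaussPDF (x : ℝ) : ℝ :=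
  Real.exp (-x ^ 2 / 2) / Real.sqrt (2 * Real.pi)

/-- The standard Gaussian cdf `Φ(x) = ∫_{−∞}^x φ(t) dt`. -/
noncomputable def stdGaussCDF (x : ℝ) : ℝ := ∫ t in Iio x, stdGaussPDF t

lemma stdGaussPDF_eq_gaussianPDFReal : stdGaussPDF = ProbabilityTheory.gaussianPDFReal 0 1 := by
  ext x
  simp [stdGaussPDF, ProbabilityTheory.gaussianPDFReal, div_eq_inv_mul]

lemma continuous_stdGaussPDF : Continuous stdGaussPDF := by
  unfold stdGaussPDF
  fun_prop

lemma integrable_stdGaussPDF : Integrable stdGaussPDF :=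
  stdGaussPDF_eq_gaussianPDFReal ▸ ProbabilityTheory.integrable_gaussianPDFReal 0 1

lemma integral_stdGaussPDF : ∫ x, stdGaussPDF x = 1 :=
  stdGaussPDF_eq_gaussianPDFReal ▸
    ProbabilityTheory.integral_gaussianPDFReal_eq_one 0 one_ne_zero

lemma stdGaussPDF_pos (x : ℝ) : 0 < stdGaussPDF x := by
  unfold stdGaussPDF
  positivity

lemma stdGaussPDF_neg (x : ℝ) : stdGaussPDF (-x) = stdGaussPDF x := by
  simp [stdGaussPDF]

lemma stdGaussPDF_le_one (x : ℝ) : stdGaussPDF x ≤ 1 := by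
  unfold stdGaussPDF
  have h : 1 ≤ Real.sqrt (2 * Real.pi) :=
    Real.one_le_sqrt.2 (by linarith [Real.pi_gt_three])
  have h' : Real.exp (-x ^ 2 / 2) ≤ 1 := Real.exp_le_one_iff.2 (by nlinarith [sq_nonneg x])
  rw [div_le_one (by linarith)]
  linarith

lemma hasDerivAt_stdGaussPDF (x : ℝ) : HasDerivAt stdGaussPDF (-x * stdGaussPDF x) x := by
  unfold stdGaussPDF
  have h : HasDerivAt (fun y : ℝ => -y ^ 2 / 2) (-x) x := by
    refine ((hasDerivAt_pow 2 x).neg.div_const 2).congr_deriv ?_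
    push_cast
    ring
  refine (h.exp.div_const (Real.sqrt (2 * Real.pi))).congr_deriv ?_
  ring

lemma stdGaussCDF_nonneg (x : ℝ) : 0 ≤ stdGaussCDF x :=
  integral_nonneg fun t => (stdGaussPDF_pos t).le

lemma hasDerivAt_stdGaussCDF (x : ℝ) : HasDerivAt stdGaussCDF (stdGaussPDF x) x := by
  have h : stdGaussCDF = fun y => stdGaussCDF 0 + ∫ t in (0 : ℝ)..y, stdGaussPDF t := by
    ext y
    rw [← intervalIntegral.integral_Iic_sub_Iic integrable_stdGaussPDF.integrableOn
      integrable_stdGaussPDF.integrableOn]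
    simp [stdGaussCDF, integral_Iic_eq_integral_Iio]
  rw [h]
  exact (continuous_stdGaussPDF.integral_hasStrictDerivAt 0 x).hasDerivAt.const_add _

lemma one_sub_stdGaussCDF (x : ℝ) : 1 - stdGaussCDF x = stdGaussCDF (-x) := by
  have h := integral_add_compl (measurableSet_Iic (a := x)) integrable_stdGaussPDF
  have h' := integral_comp_neg_Iic (-x) stdGaussPDF
  simp only [stdGaussPDF_neg, neg_neg] at h'
  rw [compl_Iic, integral_stdGaussPDF, ← h'] at h
  rw [stdGaussCDF, stdGaussCDF, ← integral_Iic_eq_integral_Iio, ← integral_Iic_eq_integral_Iio]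
  linarith

lemma strictMonoOn_stdGaussCDF_sub :
    StrictMonoOn (fun x => stdGaussCDF x - stdGaussPDF x / (1 - x)) (Iic 0) := by
  have hd (x : ℝ) (hx : x ≤ 0) : HasDerivAt (fun x => stdGaussCDF x - stdGaussPDF x / (1 - x))
      (stdGaussPDF x * -x / (1 - x) ^ 2) x := by
    have h1 : 1 - x ≠ 0 := by linarith
    refine ((hasDerivAt_stdGaussCDF x).sub
      ((hasDerivAt_stdGaussPDF x).div ((hasDerivAt_id' x).const_sub 1) h1)).congr_deriv ?_
    field_simp
    ring
  refine strictMonoOn_of_deriv_pos (convex_Iic 0)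
    (fun x hx => (hd x hx).continuousAt.continuousWithinAt) fun x hx => ?_
  rw [interior_Iic, mem_Iio] at hx
  rw [(hd x hx.le).deriv]
  have := stdGaussPDF_pos x
  have : 0 < 1 - x := by linarith
  have : 0 < -x := by linarith
  positivity

lemma stdGaussPDF_div_lt_stdGaussCDF {x : ℝ} (hx : x ≤ 0) :
    stdGaussPDF x / (1 - x) < stdGaussCDF x := by
  have hlt := strictMonoOn_stdGaussCDF_sub (show x - 1 ∈ Iic 0 by simp; linarith) hx
    (sub_one_lt x)
  have hlim : Filter.Tendsto (fun y : ℝ => -(1 - y)⁻¹) Filter.atBot (nhds 0) := by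
    simpa [sub_eq_add_neg] using (tendsto_inv_atTop_zero.comp
      (Filter.tendsto_atTop_add_const_left _ (1 : ℝ) Filter.tendsto_neg_atBot_atTop)).neg
  have hnonneg : 0 ≤ stdGaussCDF (x - 1) - stdGaussPDF (x - 1) / (1 - (x - 1)) := by
    refine le_of_tendsto hlim ?_
    filter_upwards [Filter.eventually_le_atBot (x - 1)] with y hy
    have hmono := strictMonoOn_stdGaussCDF_sub.monotoneOn (show y ∈ Iic 0 by simp; linarith)
      (show x - 1 ∈ Iic 0 by simp; linarith) hy
    have hdiv : stdGaussPDF y / (1 - y) ≤ (1 - y)⁻¹ := by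
      rw [← one_div]
      exact div_le_div_of_nonneg_right (stdGaussPDF_le_one y) (by linarith)
    have := stdGaussCDF_nonneg y
    linarith
  simp only at hlt
  linarith

lemma add_stdGaussPDF_div_stdGaussCDF_lt_one {x : ℝ} (hx : x ≤ 0) :
    x + stdGaussPDF x / stdGaussCDF x < 1 := by
  have h := stdGaussPDF_div_lt_stdGaussCDF hx
  have h1 : 0 < 1 - x := by linarith
  have hpos : 0 < stdGaussCDF x := (div_pos (stdGaussPDF_pos x) h1).trans h
  have : stdGaussPDF x / stdGaussCDF x < 1 - x := by
    rw [div_lt_iff₀ hpos, mul_comm]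
    exact (div_lt_iff₀ h1).1 h
  linarith

/-- For `M ~ N(μ, σ²)` with `σ > 0`: for every `t ≥ μ`,
`E[M | M ≥ t] − t = μ + σφ((t−μ)/σ)/(1 − Φ((t−μ)/σ)) − t < σ`, and for every `t ≤ μ`,
`t − E[M | M ≤ t] = t − μ + σφ((t−μ)/σ)/Φ((t−μ)/σ) < σ`. -/
theorem gaussian_truncated_mean_bounds (μ σ : ℝ) (hσ : 0 < σ) :
    (∀ t : ℝ, μ ≤ t →
      μ + σ * stdGaussPDF ((t - μ) / σ) / (1 - stdGaussCDF ((t - μ) / σ)) - t < σ) ∧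
    (∀ t : ℝ, t ≤ μ →
      t - μ + σ * stdGaussPDF ((t - μ) / σ) / stdGaussCDF ((t - μ) / σ) < σ) := by
  constructor
  · intro t ht
    have hx : -((t - μ) / σ) ≤ 0 := neg_nonpos.2 (div_nonneg (by linarith) hσ.le)
    have h := mul_lt_mul_of_pos_left (add_stdGaussPDF_div_stdGaussCDF_lt_one hx) hσ
    rw [stdGaussPDF_neg, ← one_sub_stdGaussCDF, mul_add, mul_neg, mul_div_cancel₀ _ hσ.ne',
      ← mul_div_assoc] at h
    linarith
  · intro t ht
    have hx : (t - μ) / σ ≤ 0 := div_nonpos_of_nonpos_of_nonneg (by linarith) hσ.le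
    have h := mul_lt_mul_of_pos_left (add_stdGaussPDF_div_stdGaussCDF_lt_one hx) hσ
    rw [mul_add, mul_div_cancel₀ _ hσ.ne', ← mul_div_assoc] at h
    linarith
end

section
/- Let M ~ N(μ, σ²) with σ > 0 and suppose the edges m_0 = −∞ < m_1 < ⋯ < m_{N−1} < m_N = +∞ together with centroids u_k = E[M | m_{k−1} ≤ M < m_k] form an equilibrium with N bins for bias b (i.e., m_k = (u_k + u_{k+1})/2 + b for k = 1,…,N−1). Then: (i) if b < 0, the lengths of the bins contained in [μ, ∞) are monotonically increasing, and the number of bins contained in [μ, ∞) is at most ⌊σ/(2|b|)⌋; (ii) if b > 0, the lengths of the bins contained in (−∞, μ] are monotonically decreasing, and the number of bins contained in (−∞, μ] is at most ⌊σ/(2b)⌋. -/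
open MeasureTheory Set

/-- Edges `m_0 = −∞ < m_1 < ⋯ < m_{N−1} < m_N = +∞` of an `N`-bin quantizer with interior
edges `m : Fin (N−1) → ℝ`, for a source with two-sided unbounded support. -/
noncomputable def edges2 (N : ℕ) (m : Fin (N - 1) → ℝ) (k : ℕ) : EReal :=
  if hk : k = 0 then ⊥
  else if h : k ≤ N - 1 then ((m ⟨k - 1, by omega⟩ : ℝ) : EReal)
  else ⊤

/-- `N`-bin cheap-talk equilibrium for a source with density `f` on `ℝ` and bias `b`. -/
def IsEq2 (f : ℝ → ℝ) (b : ℝ) (N : ℕ) (m : Fin (N - 1) → ℝ) : Prop :=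
  StrictMono m ∧ ∀ k : Fin (N - 1),
    m k = (condMean f (ebin (edges2 N m k.val) (edges2 N m (k.val + 1)))
         + condMean f (ebin (edges2 N m (k.val + 1)) (edges2 N m (k.val + 2)))) / 2 + b

/-- The `N(μ, σ²)` Gaussian density. -/
noncomputable def gaussPDF (μ σ : ℝ) (x : ℝ) : ℝ :=
  Real.exp (-(x - μ) ^ 2 / (2 * σ ^ 2)) / (σ * Real.sqrt (2 * Real.pi))

lemma condMean_congr_set {f : ℝ → ℝ} {s t : Set ℝ} (h : s =ᵐ[volume] t) :
    condMean f s = condMean f t := by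
  simp only [condMean, setIntegral_congr_set h]

/-- Reflecting both the density and the conditioning event negates the conditional mean. -/
lemma condMean_comp_neg (f : ℝ → ℝ) (s : Set ℝ) :
    condMean (fun x ↦ f (-x)) (Neg.neg ⁻¹' s) = -condMean f s := by
  have key (g : ℝ → ℝ) : ∫ x in Neg.neg ⁻¹' s, g (-x) = ∫ x in s, g x :=
    (Measure.measurePreserving_neg volume).setIntegral_preimage_emb
      (MeasurableEquiv.neg ℝ).measurableEmbedding g s
  have h := key fun x ↦ -x * f x
  simp only [neg_neg] at h
  rw [condMean, condMean, key f, h, ← neg_div, ← integral_neg]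
  simp only [neg_mul]

lemma setIntegral_pos_of_pos_off_point {g : ℝ → ℝ} {s : Set ℝ} (hs : MeasurableSet s)
    (hvol : volume s ≠ 0) (hg : IntegrableOn g s) (p : ℝ) (h : ∀ x ∈ s, x ≠ p → 0 < g x)
    (hp : 0 ≤ g p) : 0 < ∫ x in s, g x := by
  rw [setIntegral_pos_iff_support_of_nonneg_ae _ hg]
  · have hsub : s \ {p} ⊆ Function.support g ∩ s := fun x hx ↦ ⟨(h x hx.1 hx.2).ne', hx.1⟩
    refine lt_of_lt_of_le ?_ (measure_mono hsub)
    rw [measure_sdiff_null (by simp)]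
    exact pos_iff_ne_zero.2 hvol
  · refine (ae_restrict_iff' hs).2 (ae_of_all _ fun x hx ↦ ?_)
    by_cases hxp : x = p
    · simpa [hxp] using hp
    · exact (h x hx hxp).le

lemma condMean_lt_iff {f : ℝ → ℝ} {s : Set ℝ} (hf : IntegrableOn f s)
    (hxf : IntegrableOn (fun x ↦ x * f x) s)
    (hpos : 0 < ∫ x in s, f x) (c : ℝ) :
    condMean f s < c ↔ 0 < ∫ x in s, (c - x) * f x := by
  simp only [sub_mul]
  rw [condMean, div_lt_iff₀ hpos, integral_sub (hf.const_mul c) hxf, integral_const_mul, sub_pos]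

section gaussPDF
variable {μ σ : ℝ}

lemma gaussPDF_pos (hσ : 0 < σ) (x : ℝ) : 0 < gaussPDF μ σ x := by
  unfold gaussPDF; positivity

lemma gaussPDF_neg (x : ℝ) : gaussPDF (-μ) σ (-x) = gaussPDF μ σ x := by
  unfold gaussPDF; congr 4; ring

lemma gaussPDF_lt (hσ : 0 < σ) {x y : ℝ} (hx : μ ≤ x) (hxy : x < y) :
    gaussPDF μ σ y < gaussPDF μ σ x := by
  unfold gaussPDF
  gcongr ?_ / _
  apply Real.exp_lt_exp.2
  gcongr ?_ / _
  nlinarith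

lemma hasDerivAt_gaussPDF (hσ : 0 < σ) (x : ℝ) :
    HasDerivAt (gaussPDF μ σ) (-((x - μ) / σ ^ 2) * gaussPDF μ σ x) x := by
  have h1 : HasDerivAt (fun x : ℝ ↦ -(x - μ) ^ 2 / (2 * σ ^ 2)) (-((x - μ) / σ ^ 2)) x := by
    refine ((((hasDerivAt_id' x).sub_const μ).pow 2).neg.div_const (2 * σ ^ 2)).congr_deriv ?_
    field_simp
    simp [mul_comm]
  refine (h1.exp.div_const (σ * Real.sqrt (2 * Real.pi))).congr_deriv ?_
  rw [gaussPDF]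
  ring

lemma integrable_pow_mul_gaussPDF (hσ : 0 < σ) (n : ℕ) :
    Integrable fun x ↦ (x - μ) ^ n * gaussPDF μ σ x := by
  have h := (integrable_rpow_mul_exp_neg_mul_sq (b := (2 * σ ^ 2)⁻¹) (by positivity) (s := n)
    (by linarith [(Nat.cast_nonneg n : (0 : ℝ) ≤ n)])).comp_sub_right μ
  convert h.div_const (σ * Real.sqrt (2 * Real.pi)) using 2 with x
  rw [gaussPDF, Real.rpow_natCast]
  ring_nf

lemma integrable_gaussPDF (hσ : 0 < σ) : Integrable (gaussPDF μ σ) := by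
  simpa using integrable_pow_mul_gaussPDF (μ := μ) hσ 0

lemma integrable_quadratic_mul_gaussPDF (hσ : 0 < σ) {q : ℝ → ℝ} (A B C : ℝ)
    (hq : ∀ x, q x = A + B * (x - μ) + C * (x - μ) ^ 2) :
    Integrable fun x ↦ q x * gaussPDF μ σ x := by
  refine ((((integrable_pow_mul_gaussPDF (μ := μ) hσ 0).const_mul A).add
    ((integrable_pow_mul_gaussPDF (μ := μ) hσ 1).const_mul B)).add
    ((integrable_pow_mul_gaussPDF (μ := μ) hσ 2).const_mul C)).congr (ae_of_all _ fun x ↦ ?_)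
  simp only [hq, Pi.add_apply]
  ring

lemma integrable_linear_mul_gaussPDF (hσ : 0 < σ) (A B : ℝ) :
    Integrable fun x ↦ (A + B * x) * gaussPDF μ σ x :=
  integrable_quadratic_mul_gaussPDF hσ (A + B * μ) B 0 fun x ↦ by ring

lemma integrable_id_mul_gaussPDF (hσ : 0 < σ) : Integrable fun x ↦ x * gaussPDF μ σ x := by
  simpa using integrable_linear_mul_gaussPDF (μ := μ) hσ 0 1

lemma setIntegral_gaussPDF_pos (hσ : 0 < σ) {s : Set ℝ} (hs : MeasurableSet s)
    (hvol : volume s ≠ 0) : 0 < ∫ x in s, gaussPDF μ σ x :=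
  setIntegral_pos_of_pos_off_point hs hvol (integrable_gaussPDF hσ).integrableOn 0
    (fun x _ _ ↦ gaussPDF_pos hσ x) (gaussPDF_pos hσ 0).le

lemma condMean_gaussPDF_lt_iff (hσ : 0 < σ) {s : Set ℝ} (hs : MeasurableSet s)
    (hvol : volume s ≠ 0) (c : ℝ) :
    condMean (gaussPDF μ σ) s < c ↔ 0 < ∫ x in s, (c - x) * gaussPDF μ σ x :=
  condMean_lt_iff (integrable_gaussPDF hσ).integrableOn
    (integrable_id_mul_gaussPDF hσ).integrableOn (setIntegral_gaussPDF_pos hσ hs hvol) c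

lemma condMean_gaussPDF_lt (hσ : 0 < σ) {s : Set ℝ} (hs : MeasurableSet s)
    (hvol : volume s ≠ 0) {c : ℝ} (hc : ∀ x ∈ s, x ≤ c) : condMean (gaussPDF μ σ) s < c := by
  rw [condMean_gaussPDF_lt_iff hσ hs hvol]
  refine setIntegral_pos_of_pos_off_point hs hvol ?_ c (fun x hx hxc ↦ ?_) (by simp)
  · simpa [sub_eq_add_neg] using (integrable_linear_mul_gaussPDF (μ := μ) hσ c (-1)).integrableOn
  · exact mul_pos (sub_pos.2 ((hc x hx).lt_of_ne hxc)) (gaussPDF_pos hσ x)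

lemma condMean_gaussPDF_preimage_neg (s : Set ℝ) :
    condMean (gaussPDF (-μ) σ) (Neg.neg ⁻¹' s) = -condMean (gaussPDF μ σ) s := by
  rw [← condMean_comp_neg]
  congr 1
  ext x
  rw [← gaussPDF_neg, neg_neg]

lemma lt_condMean_gaussPDF (hσ : 0 < σ) {s : Set ℝ} (hs : MeasurableSet s)
    (hvol : volume s ≠ 0) {c : ℝ} (hc : ∀ x ∈ s, c ≤ x) : c < condMean (gaussPDF μ σ) s := by
  have h := condMean_gaussPDF_lt (μ := -μ) hσ (measurable_neg hs)
    (by rwa [(Measure.measurePreserving_neg volume).measure_preimage hs.nullMeasurableSet])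
    (c := -c) fun x hx ↦ le_neg.1 (hc _ hx)
  rw [condMean_gaussPDF_preimage_neg] at h
  linarith

/-- Right of the mean the density decreases, so centroids lie left of midpoints. -/
lemma condMean_gaussPDF_Ioo_lt_midpoint (hσ : 0 < σ) {a c : ℝ} (hac : a < c) (hμ : μ ≤ a) :
    condMean (gaussPDF μ σ) (Ioo a c) < (a + c) / 2 := by
  have hvol : volume (Ioo a c) ≠ 0 := by simpa using hac
  set p := (a + c) / 2 with hp
  have hint : IntegrableOn (fun x ↦ (p - x) * gaussPDF μ σ x) (Ioo a c) := by
    simpa [sub_eq_add_neg] using (integrable_linear_mul_gaussPDF (μ := μ) hσ p (-1)).integrableOn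
  have hint' : IntegrableOn (fun x ↦ (p - x) * gaussPDF μ σ p) (Ioo a c) :=
    ((by fun_prop : Continuous fun x ↦ (p - x) * gaussPDF μ σ p).integrableOn_Icc).mono_set
      Ioo_subset_Icc_self
  have hzero : ∫ x in Ioo a c, (p - x) * gaussPDF μ σ p = 0 := by
    rw [← integral_Ioc_eq_integral_Ioo, ← intervalIntegral.integral_of_le hac.le,
      intervalIntegral.integral_mul_const,
      intervalIntegral.integral_sub (by simp) (by simp)]
    simp only [intervalIntegral.integral_const, integral_id, smul_eq_mul]
    rw [hp]
    ring
  rw [condMean_gaussPDF_lt_iff hσ measurableSet_Ioo hvol]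
  have hpos : 0 < ∫ x in Ioo a c, ((p - x) * gaussPDF μ σ x - (p - x) * gaussPDF μ σ p) := by
    refine setIntegral_pos_of_pos_off_point measurableSet_Ioo hvol (hint.sub hint') p
      (fun x hx hxp ↦ ?_) (by simp)
    rw [← mul_sub]
    rcases lt_or_gt_of_ne hxp with h | h
    · exact mul_pos (by linarith) (sub_pos.2 (gaussPDF_lt hσ (by linarith [hx.1]) h))
    · exact mul_pos_of_neg_of_neg (by linarith)
        (sub_neg.2 (gaussPDF_lt hσ (by linarith [hx.1]) h))
  rwa [integral_sub hint hint', hzero, sub_zero] at hpos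

/-- The mean residual of a Gaussian beyond a point right of its mean is less than `σ`. -/
lemma condMean_gaussPDF_Ioi_lt (hσ : 0 < σ) {a : ℝ} (hμ : μ ≤ a) :
    condMean (gaussPDF μ σ) (Ioi a) < a + σ := by
  rw [condMean_gaussPDF_lt_iff hσ measurableSet_Ioi (by simp)]
  set d : ℝ → ℝ := fun x ↦ (1 - (x - a) * (x - μ) / σ ^ 2) * gaussPDF μ σ x
  have hderiv : ∀ x, HasDerivAt (fun x ↦ (x - a) * gaussPDF μ σ x) (d x) x := fun x ↦ by
    refine (((hasDerivAt_id' x).sub_const a).mul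
      (hasDerivAt_gaussPDF (μ := μ) hσ x)).congr_deriv ?_
    simp only [d]
    ring
  have hd : IntegrableOn d (Ioi a) := by
    refine (integrable_quadratic_mul_gaussPDF hσ 1 ((a - μ) / σ ^ 2) (-1 / σ ^ 2)
      fun x ↦ ?_).integrableOn
    ring
  have hF : IntegrableOn (fun x ↦ (x - a) * gaussPDF μ σ x) (Ioi a) := by
    refine (integrable_quadratic_mul_gaussPDF hσ (μ - a) 1 0 fun x ↦ ?_).integrableOn
    ring
  have hzero : ∫ x in Ioi a, d x = 0 := by
    rw [integral_Ioi_of_hasDerivAt_of_tendsto' (fun x _ ↦ hderiv x) hd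
      (tendsto_zero_of_hasDerivAt_of_integrableOn_Ioi (fun x _ ↦ hderiv x) hd hF)]
    simp
  have hint : IntegrableOn (fun x ↦ (a + σ - x) * gaussPDF μ σ x) (Ioi a) := by
    simpa [sub_eq_add_neg] using
      (integrable_linear_mul_gaussPDF (μ := μ) hσ (a + σ) (-1)).integrableOn
  have hsq : ∀ x, (a + σ - x) * gaussPDF μ σ x - σ / 2 * d x =
      ((a + σ - x) ^ 2 / (2 * σ) + (x - a) * (a - μ) / (2 * σ)) * gaussPDF μ σ x := fun x ↦ by
    simp only [d]
    field_simp
    ring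
  have hpos : 0 < ∫ x in Ioi a, ((a + σ - x) * gaussPDF μ σ x - σ / 2 * d x) := by
    refine setIntegral_pos_of_pos_off_point measurableSet_Ioi (by simp)
      (hint.sub (hd.const_mul _)) (a + σ) (fun x hx hxp ↦ ?_) ?_ <;> rw [hsq]
    · have h1 : 0 < (a + σ - x) ^ 2 := sq_pos_of_ne_zero (sub_ne_zero.2 hxp.symm)
      have h2 : 0 ≤ (x - a) * (a - μ) :=
        mul_nonneg (sub_nonneg.2 (le_of_lt hx)) (sub_nonneg.2 hμ)
      have := gaussPDF_pos (μ := μ) hσ x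
      positivity
    · have h2 : 0 ≤ (a + σ - a) * (a - μ) := mul_nonneg (by linarith) (sub_nonneg.2 hμ)
      have := gaussPDF_pos (μ := μ) hσ (a + σ)
      positivity
  rwa [integral_sub hint (hd.const_mul _), integral_const_mul, hzero, mul_zero, sub_zero] at hpos

lemma midpoint_lt_condMean_gaussPDF_Ioo (hσ : 0 < σ) {a c : ℝ} (hac : a < c) (hμ : c ≤ μ) :
    (a + c) / 2 < condMean (gaussPDF μ σ) (Ioo a c) := by
  have h := condMean_gaussPDF_Ioo_lt_midpoint hσ (neg_lt_neg hac) (neg_le_neg hμ)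
  rw [show Ioo (-c) (-a) = Neg.neg ⁻¹' Ioo a c by ext; simp [and_comm], condMean_gaussPDF_preimage_neg] at h
  linarith

lemma lt_condMean_gaussPDF_Iio (hσ : 0 < σ) {c : ℝ} (hμ : c ≤ μ) :
    c - σ < condMean (gaussPDF μ σ) (Iio c) := by
  have h := condMean_gaussPDF_Ioi_lt hσ (neg_le_neg hμ)
  rw [show Ioi (-c) = Neg.neg ⁻¹' Iio c by ext; simp, condMean_gaussPDF_preimage_neg] at h
  linarith

end gaussPDF

lemma card_mul_lt_of_step {N : ℕ} {P : ℕ → Prop} {D : ℕ → ℝ} {c s : ℝ} (hs : 0 < s)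
    (hD : ∀ k < N, P k → c < D k)
    (hstep : ∀ k, k + 1 < N → P k → P (k + 1) ∧ D k + c < D (k + 1))
    (hlast : ∀ k, k + 1 = N → P k → D k < s) :
    (Nat.card {k : Fin N // P k} : ℝ) * c < s := by
  classical
  have hcard : Nat.card {k : Fin N // P k} = Nat.count P N := by
    rw [Nat.count_eq_card_filter_range, ← Fintype.card_coe, ← Nat.card_eq_fintype_card]
    exact Nat.card_congr
      ⟨fun k ↦ ⟨k.1, by simp [k.2]⟩, fun k ↦ ⟨⟨k.1, by simpa using (Finset.mem_filter.1 k.2).1⟩,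
        (Finset.mem_filter.1 k.2).2⟩, fun _ ↦ rfl, fun _ ↦ rfl⟩
  have key : ∀ k < N, (P k ∧ (Nat.count P (k + 1) : ℝ) * c < D k) ∨ Nat.count P (k + 1) = 0 := by
    have first : ∀ k < N, Nat.count P k = 0 →
        (P k ∧ (Nat.count P (k + 1) : ℝ) * c < D k) ∨ Nat.count P (k + 1) = 0 := by
      intro k hk h0
      by_cases hP : P k
      · left
        simpa [Nat.count_succ, h0, hP] using hD k hk hP
      · right
        simp [Nat.count_succ, h0, hP]
    intro k
    induction k with
    | zero => exact fun hk ↦ first 0 hk (Nat.count_zero P)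
    | succ k ih =>
      intro hk
      rcases ih (by omega) with ⟨hP, hlt⟩ | h0
      · obtain ⟨hP', hlt'⟩ := hstep k hk hP
        refine Or.inl ⟨hP', ?_⟩
        rw [Nat.count_succ, if_pos hP']
        push_cast
        linarith
      · exact first _ hk h0
  rw [hcard]
  rcases N with _ | n
  · simpa using hs
  · rcases key n n.lt_succ_self with ⟨hP, hlt⟩ | h0
    · exact hlt.trans (hlast n rfl hP)
    · simpa [h0] using hs

section ebin
variable {lo hi : EReal}

lemma measurableSet_ebin : MeasurableSet (ebin lo hi) :=
  measurable_coe_real_ereal measurableSet_Ico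

lemma volume_ebin_ne_zero (h : lo < hi) : volume (ebin lo hi) ≠ 0 := by
  obtain ⟨x, hx⟩ := EReal.lt_iff_exists_real_btwn.1 h
  have hopen : IsOpen ((↑) ⁻¹' Ioo lo hi : Set ℝ) := isOpen_Ioo.preimage continuous_coe_real_ereal
  have hsub : ((↑) ⁻¹' Ioo lo hi : Set ℝ) ⊆ ebin lo hi := fun y hy ↦ ⟨hy.1.le, hy.2⟩
  exact ((hopen.measure_pos volume ⟨x, hx⟩).trans_le (measure_mono hsub)).ne'

lemma ebin_subset_Ici_iff (h : lo < hi) {μ : ℝ} : ebin lo hi ⊆ Ici μ ↔ (μ : EReal) ≤ lo := by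
  refine ⟨fun hsub ↦ ?_, fun hμ x hx ↦ EReal.coe_le_coe_iff.1 (hμ.trans hx.1)⟩
  by_contra! hlt
  obtain ⟨x, hx, hx'⟩ := EReal.lt_iff_exists_real_btwn.1 (lt_min hlt h)
  have := hsub (show x ∈ ebin lo hi from ⟨hx.le, hx'.trans_le (min_le_right _ _)⟩)
  exact (EReal.coe_lt_coe_iff.1 (hx'.trans_le (min_le_left _ _))).not_ge this

lemma ebin_subset_Iic_iff (h : lo < hi) {μ : ℝ} : ebin lo hi ⊆ Iic μ ↔ hi ≤ (μ : EReal) := by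
  refine ⟨fun hsub ↦ ?_, fun hμ x hx ↦ EReal.coe_le_coe_iff.1 (hx.2.le.trans hμ)⟩
  by_contra! hlt
  obtain ⟨x, hx, hx'⟩ := EReal.lt_iff_exists_real_btwn.1 (max_lt hlt h)
  have := hsub (show x ∈ ebin lo hi from ⟨((le_max_right _ _).trans_lt hx).le, hx'⟩)
  exact (EReal.coe_lt_coe_iff.1 ((le_max_left _ _).trans_lt hx)).not_ge this

variable (f : ℝ → ℝ) (a c : ℝ)

lemma condMean_ebin_coe_coe : condMean f (ebin a c) = condMean f (Ioo a c) := by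
  rw [show ebin a c = Ico a c by ext; simp [ebin]]
  exact condMean_congr_set Ioo_ae_eq_Ico.symm

lemma condMean_ebin_coe_top : condMean f (ebin a ⊤) = condMean f (Ioi a) := by
  rw [show ebin a ⊤ = Ici a by ext; simp [ebin]]
  exact condMean_congr_set Ioi_ae_eq_Ici.symm

lemma condMean_ebin_bot_coe : condMean f (ebin ⊥ c) = condMean f (Iio c) := by
  rw [show ebin ⊥ c = Iio c by ext; simp [ebin]]

end ebin

section edges2
variable {N : ℕ} {m : Fin (N - 1) → ℝ} {k : ℕ}

lemma edges2_zero : edges2 N m 0 = ⊥ := by simp [edges2]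

lemma edges2_of_le (h1 : 1 ≤ k) (h2 : k ≤ N - 1) :
    edges2 N m k = (m ⟨k - 1, by omega⟩ : ℝ) := by
  simp [edges2, h2, Nat.one_le_iff_ne_zero.1 h1]

lemma edges2_of_gt (h1 : 1 ≤ k) (h : N - 1 < k) : edges2 N m k = ⊤ := by
  simp [edges2, h, Nat.one_le_iff_ne_zero.1 h1]

lemma edges2_lt_succ (hm : StrictMono m) (hk : k < N) : edges2 N m k < edges2 N m (k + 1) := by
  rcases Nat.eq_zero_or_pos k with rfl | hpos
  · rw [edges2_zero]
    by_cases h : 0 + 1 ≤ N - 1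
    · rw [edges2_of_le (by omega) h]
      exact EReal.bot_lt_coe _
    · rw [edges2_of_gt (by omega) (by omega)]
      exact bot_lt_top
  · rw [edges2_of_le hpos (by omega)]
    by_cases h : k + 1 ≤ N - 1
    · rw [edges2_of_le (by omega) h]
      exact EReal.coe_lt_coe_iff.2 (hm (Fin.mk_lt_mk.2 (by omega)))
    · rw [edges2_of_gt (by omega) (by omega)]
      exact EReal.coe_lt_top _

/-- The interior edges, indexed by natural numbers so that edge `k` separates the bins `k - 1` and
`k` (counted from zero). -/
noncomputable def interiorEdge (N : ℕ) (m : Fin (N - 1) → ℝ) (k : ℕ) : ℝ := (edges2 N m k).toReal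

lemma interiorEdge_of_le (h1 : 1 ≤ k) (h2 : k ≤ N - 1) :
    interiorEdge N m k = m ⟨k - 1, by omega⟩ := by
  rw [interiorEdge, edges2_of_le h1 h2, EReal.toReal_coe]

lemma coe_interiorEdge (h1 : 1 ≤ k) (h2 : k ≤ N - 1) :
    (interiorEdge N m k : EReal) = edges2 N m k := by
  rw [interiorEdge_of_le h1 h2, edges2_of_le h1 h2]

/-- The receiver action on bin `k` (counted from zero). -/
noncomputable def action (f : ℝ → ℝ) (N : ℕ) (m : Fin (N - 1) → ℝ) (k : ℕ) : ℝ :=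
  condMean f (ebin (edges2 N m k) (edges2 N m (k + 1)))

lemma IsEq2.interiorEdge_succ {f : ℝ → ℝ} {b : ℝ} (heq : IsEq2 f b N m) (hk : k + 1 ≤ N - 1) :
    interiorEdge N m (k + 1) = (action f N m k + action f N m (k + 1)) / 2 + b := by
  rw [interiorEdge_of_le (by omega) hk]
  exact heq.2 ⟨k, hk⟩

lemma interiorEdge_lt_succ (hm : StrictMono m) (h1 : 1 ≤ k) (hk : k + 1 ≤ N - 1) :
    interiorEdge N m k < interiorEdge N m (k + 1) := by
  rw [← EReal.coe_lt_coe_iff, coe_interiorEdge h1 (by omega), coe_interiorEdge (by omega) hk]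
  exact edges2_lt_succ hm (by omega)

variable {μ σ : ℝ}

lemma interiorEdge_lt_action (hσ : 0 < σ) (hm : StrictMono m) (h1 : 1 ≤ k) (hk : k ≤ N - 1) :
    interiorEdge N m k < action (gaussPDF μ σ) N m k := by
  refine lt_condMean_gaussPDF hσ measurableSet_ebin
    (volume_ebin_ne_zero (edges2_lt_succ hm (by omega))) fun x hx ↦ ?_
  rw [← EReal.coe_le_coe_iff, coe_interiorEdge h1 hk]
  exact hx.1

lemma action_lt_interiorEdge (hσ : 0 < σ) (hm : StrictMono m) (hk : k + 1 ≤ N - 1) :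
    action (gaussPDF μ σ) N m k < interiorEdge N m (k + 1) := by
  refine condMean_gaussPDF_lt hσ measurableSet_ebin
    (volume_ebin_ne_zero (edges2_lt_succ hm (by omega))) fun x hx ↦ ?_
  rw [← EReal.coe_le_coe_iff, coe_interiorEdge (by omega) hk]
  exact hx.2.le

lemma action_lt_midpoint (hσ : 0 < σ) (hm : StrictMono m) (h1 : 1 ≤ k) (hk : k + 1 ≤ N - 1)
    (hμ : μ ≤ interiorEdge N m k) :
    action (gaussPDF μ σ) N m k < (interiorEdge N m k + interiorEdge N m (k + 1)) / 2 := by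
  rw [action, ← coe_interiorEdge h1 (by omega), ← coe_interiorEdge (by omega) hk,
    condMean_ebin_coe_coe]
  exact condMean_gaussPDF_Ioo_lt_midpoint hσ (interiorEdge_lt_succ hm h1 hk) hμ

lemma midpoint_lt_action (hσ : 0 < σ) (hm : StrictMono m) (h1 : 1 ≤ k) (hk : k + 1 ≤ N - 1)
    (hμ : interiorEdge N m (k + 1) ≤ μ) :
    (interiorEdge N m k + interiorEdge N m (k + 1)) / 2 < action (gaussPDF μ σ) N m k := by
  rw [action, ← coe_interiorEdge h1 (by omega), ← coe_interiorEdge (by omega) hk,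
    condMean_ebin_coe_coe]
  exact midpoint_lt_condMean_gaussPDF_Ioo hσ (interiorEdge_lt_succ hm h1 hk) hμ

lemma action_last_lt (hσ : 0 < σ) (h1 : 1 ≤ k) (hk : k + 1 = N) (hμ : μ ≤ interiorEdge N m k) :
    action (gaussPDF μ σ) N m k < interiorEdge N m k + σ := by
  rw [action, ← coe_interiorEdge h1 (by omega), edges2_of_gt (by omega) (by omega),
    condMean_ebin_coe_top]
  exact condMean_gaussPDF_Ioi_lt hσ hμ

lemma lt_action_zero (hσ : 0 < σ) (hN : 1 ≤ N - 1) (hμ : interiorEdge N m 1 ≤ μ) :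
    interiorEdge N m 1 - σ < action (gaussPDF μ σ) N m 0 := by
  rw [action, zero_add, ← coe_interiorEdge le_rfl hN, edges2_zero, condMean_ebin_bot_coe]
  exact lt_condMean_gaussPDF_Iio hσ hμ

lemma bin_subset_Ici_iff (hm : StrictMono m) (hk : k < N) :
    ebin (edges2 N m k) (edges2 N m (k + 1)) ⊆ Ici μ ↔ 1 ≤ k ∧ μ ≤ interiorEdge N m k := by
  rw [ebin_subset_Ici_iff (edges2_lt_succ hm hk)]
  rcases Nat.eq_zero_or_pos k with rfl | hpos
  · simp [edges2_zero]
  · rw [← coe_interiorEdge hpos (by omega), EReal.coe_le_coe_iff]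
    exact (and_iff_right hpos).symm

lemma bin_subset_Iic_iff (hm : StrictMono m) (hk : k < N) :
    ebin (edges2 N m k) (edges2 N m (k + 1)) ⊆ Iic μ ↔
      k + 1 ≤ N - 1 ∧ interiorEdge N m (k + 1) ≤ μ := by
  rw [ebin_subset_Iic_iff (edges2_lt_succ hm hk)]
  by_cases h : k + 1 ≤ N - 1
  · rw [← coe_interiorEdge (by omega) h, EReal.coe_le_coe_iff]
    exact (and_iff_right h).symm
  · simp [edges2_of_gt (N := N) (m := m) (k := k + 1) (by omega) (by omega), h]

variable {b : ℝ}

lemma IsEq2.card_bins_subset_Ici_mul_lt (hσ : 0 < σ) (heq : IsEq2 (gaussPDF μ σ) b N m) :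
    (Nat.card {k : Fin N // ebin (edges2 N m k.val) (edges2 N m (k.val + 1)) ⊆ Ici μ} : ℝ)
      * (-(2 * b)) < σ := by
  have hm := heq.1
  refine card_mul_lt_of_step (P := fun k ↦ ebin (edges2 N m k) (edges2 N m (k + 1)) ⊆ Ici μ)
    (D := fun k ↦ action (gaussPDF μ σ) N m k - interiorEdge N m k) hσ ?_ ?_ ?_
  · intro k hk hP
    obtain ⟨h1, -⟩ := (bin_subset_Ici_iff hm hk).1 hP
    obtain ⟨j, rfl⟩ := Nat.exists_eq_add_of_le' h1
    have := heq.interiorEdge_succ (k := j) (by omega)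
    have := action_lt_interiorEdge (μ := μ) hσ hm (k := j) (by omega)
    linarith
  · intro k hk hP
    obtain ⟨h1, hμ⟩ := (bin_subset_Ici_iff hm (by omega)).1 hP
    have hlt := interiorEdge_lt_succ hm h1 (by omega)
    refine ⟨(bin_subset_Ici_iff hm hk).2 ⟨by omega, hμ.trans hlt.le⟩, ?_⟩
    have := heq.interiorEdge_succ (k := k) (by omega)
    have := action_lt_midpoint hσ hm h1 (by omega) hμ
    linarith
  · intro k hk hP
    obtain ⟨h1, hμ⟩ := (bin_subset_Ici_iff hm (by omega)).1 hP
    exact sub_lt_iff_lt_add'.2 (action_last_lt hσ h1 hk hμ)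

lemma IsEq2.card_bins_subset_Iic_mul_lt (hσ : 0 < σ) (heq : IsEq2 (gaussPDF μ σ) b N m) :
    (Nat.card {k : Fin N // ebin (edges2 N m k.val) (edges2 N m (k.val + 1)) ⊆ Iic μ} : ℝ)
      * (2 * b) < σ := by
  have hm := heq.1
  set Q : ℕ → Prop := fun k ↦ ebin (edges2 N m k) (edges2 N m (k + 1)) ⊆ Iic μ
  have hcard : Nat.card {k : Fin N // Q k} = Nat.card {k : Fin N // Q (N - 1 - k)} := by
    refine Nat.card_congr (Fin.revPerm.subtypeEquiv fun k ↦ ?_)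
    rw [show N - 1 - (Fin.revPerm k : Fin N) = k by simp [Fin.val_rev]; omega]
  rw [hcard]
  refine card_mul_lt_of_step (P := fun k ↦ Q (N - 1 - k))
    (D := fun k ↦ interiorEdge N m (N - 1 - k + 1) - action (gaussPDF μ σ) N m (N - 1 - k))
    hσ ?_ ?_ ?_
  · intro k hk hP
    obtain ⟨h1, -⟩ := (bin_subset_Iic_iff hm (by omega)).1 hP
    have := heq.interiorEdge_succ h1
    have := interiorEdge_lt_action (μ := μ) hσ hm (k := N - 1 - k + 1) (by omega) h1
    linarith
  · intro k hk hP
    obtain ⟨h1, hμ⟩ := (bin_subset_Iic_iff hm (by omega)).1 hP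
    obtain ⟨j, hj⟩ : ∃ j, N - 1 - k = j + 1 := ⟨N - 1 - (k + 1), by omega⟩
    rw [show N - 1 - (k + 1) = j by omega]
    rw [hj] at h1 hμ ⊢
    have hlt := interiorEdge_lt_succ hm (k := j + 1) (by omega) h1
    refine ⟨(bin_subset_Iic_iff hm (by omega)).2 ⟨by omega, hlt.le.trans hμ⟩, ?_⟩
    have := heq.interiorEdge_succ (k := j) (by omega)
    have := midpoint_lt_action hσ hm (by omega) h1 hμ
    linarith
  · intro k hk hP
    obtain ⟨h1, hμ⟩ := (bin_subset_Iic_iff hm (by omega)).1 hP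
    rw [show N - 1 - k = 0 by omega, zero_add] at h1 hμ ⊢
    exact sub_lt_comm.1 (lt_action_zero hσ h1 hμ)

end edges2

/-- For a Gaussian source `M ~ N(μ, σ²)` (`σ > 0`) at an `N`-bin
equilibrium with bias `b`: (i) if `b < 0`, the lengths of the bins contained in `[μ, ∞)` are
monotonically increasing and there are at most `⌊σ/(2|b|)⌋` bins contained in `[μ, ∞)`;
(ii) if `b > 0`, the lengths of the bins contained in `(−∞, μ]` are monotonically decreasing
and there are at most `⌊σ/(2b)⌋` bins contained in `(−∞, μ]`. -/
theorem gaussian_equilibrium_bin_monotonicity (μ σ b : ℝ) (hσ : 0 < σ)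
    (N : ℕ) (hN : 1 ≤ N) (m : Fin (N - 1) → ℝ)
    (heq : IsEq2 (gaussPDF μ σ) b N m) :
    (b < 0 →
      (∀ j : ℕ, ∀ _h1 : 1 ≤ j, ∀ _h2 : j + 1 ≤ N - 2,
        μ ≤ m ⟨j - 1, by omega⟩ →
        m ⟨j, by omega⟩ - m ⟨j - 1, by omega⟩ <
          m ⟨j + 1, by omega⟩ - m ⟨j, by omega⟩) ∧
      (Nat.card {k : Fin N //
          ebin (edges2 N m k.val) (edges2 N m (k.val + 1)) ⊆ Ici μ} : ℤ) ≤
        ⌊σ / (2 * |b|)⌋) ∧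
    (0 < b →
      (∀ j : ℕ, ∀ _h1 : 1 ≤ j, ∀ _h2 : j + 1 ≤ N - 2,
        m ⟨j + 1, by omega⟩ ≤ μ →
        m ⟨j + 1, by omega⟩ - m ⟨j, by omega⟩ <
          m ⟨j, by omega⟩ - m ⟨j - 1, by omega⟩) ∧
      (Nat.card {k : Fin N //
          ebin (edges2 N m k.val) (edges2 N m (k.val + 1)) ⊆ Iic μ} : ℤ) ≤
        ⌊σ / (2 * b)⌋) := by
  have hm := heq.1
  constructor
  · intro hb
    refine ⟨fun j h1 h2 hμ ↦ ?_, ?_⟩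
    · replace hμ : μ ≤ interiorEdge N m j := hμ.trans_eq (interiorEdge_of_le h1 (by omega)).symm
      have hlt := interiorEdge_lt_succ hm h1 (by omega)
      have hleft := action_lt_midpoint hσ hm h1 (by omega) hμ
      have hright := action_lt_midpoint (k := j + 1) hσ hm (by omega) (by omega) (hμ.trans hlt.le)
      have hedge := heq.interiorEdge_succ (k := j) (by omega)
      rw [interiorEdge_of_le h1 (by omega)] at hleft
      rw [interiorEdge_of_le (k := j + 1) (by omega) (by omega)] at hleft hright hedge
      rw [interiorEdge_of_le (k := j + 1 + 1) (by omega) (by omega)] at hright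
      simp only [Nat.add_sub_cancel] at hleft hright hedge
      linarith
    · rw [Int.le_floor, abs_of_neg hb, le_div_iff₀ (by linarith), mul_neg]
      exact_mod_cast (heq.card_bins_subset_Ici_mul_lt hσ).le
  · intro hb
    refine ⟨fun j h1 h2 hμ ↦ ?_, ?_⟩
    · replace hμ : interiorEdge N m (j + 1 + 1) ≤ μ :=
        (interiorEdge_of_le (by omega) (by omega)).trans_le hμ
      have hlt := interiorEdge_lt_succ hm (k := j + 1) (by omega) (by omega)
      have hleft := midpoint_lt_action (k := j) hσ hm h1 (by omega) (hlt.le.trans hμ)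
      have hright := midpoint_lt_action (k := j + 1) hσ hm (by omega) (by omega) hμ
      have hedge := heq.interiorEdge_succ (k := j) (by omega)
      rw [interiorEdge_of_le h1 (by omega)] at hleft
      rw [interiorEdge_of_le (k := j + 1) (by omega) (by omega)] at hleft hright hedge
      rw [interiorEdge_of_le (k := j + 1 + 1) (by omega) (by omega)] at hright
      simp only [Nat.add_sub_cancel] at hleft hright hedge
      linarith
    · rw [Int.le_floor, le_div_iff₀ (by positivity)]
      exact_mod_cast (heq.card_bins_subset_Iic_mul_lt hσ).le
end
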